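/- arXiv:2010.04808 — 3 statements merged into one kernel-verified Lean document; each statement's English description precedes it below -/
import Mathlib

section
/- Let S be a finite nonabelian simple group, let q be a prime larger than every prime divisor of |S|, and let p be a prime with p > 2q. Form the wreath product G = S ≀ A_p, i.e., the semidirect product of the direct power N = ∏_{i ∈ Fin p} S by the alternating group A_p acting by permuting the coordinates. Then G has no maximal subgroup M that is supersolvable and satisfies π(M) = π(G). -/
/-- A group is supersolvable if it has a chain of subgroups, each normal in the
whole group, starting at the trivial subgroup and ending at the whole group,
with all successive quotients cyclic. -/
def IsSupersolvable (M : Type*) [Group M] : Prop :=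
  ∃ (k : ℕ) (c : ℕ → Subgroup M),
    c 0 = ⊥ ∧ c k = ⊤ ∧ (∀ i, c i ≤ c (i + 1)) ∧
    ∃ hn : ∀ i, (c i).Normal,
      ∀ i < k, letI := hn i;
        IsCyclic ((c (i + 1)).map (QuotientGroup.mk' (c i)))

/-- The action of the alternating group `A_p` on the direct power `S^p`
by permutation of the coordinates, as a homomorphism into `MulAut (Fin p → S)`. -/
def wreathAut (S : Type*) [Group S] (p : ℕ) :
    alternatingGroup (Fin p) →* MulAut (Fin p → S) :=
  mulAutArrow.comp (alternatingGroup (Fin p)).subtype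

/-- A supersolvable group is solvable. -/
theorem IsSupersolvable.isSolvable {M : Type*} [Group M] (h : IsSupersolvable M) :
    Group.IsSolvable M := by
  obtain ⟨k, c, h0, hk, -, hn, hc⟩ := h
  have key : ∀ j ≤ k, derivedSeries M j ≤ c (k - j) := by
    intro j
    induction j with
    | zero => intro _; simp [hk]
    | succ j ih =>
      intro hj
      have hle := ih (by omega)
      obtain ⟨i, hi⟩ : ∃ i, k - j = i + 1 := ⟨k - j - 1, by omega⟩
      rw [show k - (j + 1) = i by omega, derivedSeries_succ]
      rw [hi] at hle
      have := hn i
      have hcyc := hc i (by omega)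
      refine (Subgroup.commutator_mono hle hle).trans (Subgroup.commutator_le.2 ?_)
      intro a ha b hb
      rw [← QuotientGroup.eq_one_iff, ← QuotientGroup.mk'_apply, map_commutatorElement,
        commutatorElement_eq_one_iff_mul_comm]
      exact congrArg Subtype.val (hcyc.commGroup.mul_comm
        ⟨_, Subgroup.mem_map_of_mem _ ha⟩ ⟨_, Subgroup.mem_map_of_mem _ hb⟩)
  exact ⟨k, by simpa [h0] using key k le_rfl⟩

/-- The alternating group on at least five letters is not solvable. -/
theorem alternatingGroup_not_isSolvable {α : Type*} [Fintype α] [DecidableEq α]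
    (hα : 5 ≤ Fintype.card α) : ¬ Group.IsSolvable (alternatingGroup α) := by
  intro h
  refine Equiv.Perm.not_isSolvable α (by simpa using hα) ?_
  exact Group.isSolvable_of_ker_le_range (alternatingGroup α).subtype Equiv.Perm.sign
    (by rw [Subgroup.range_subtype, alternatingGroup_eq_sign_ker])

/-- If `S` is a finite nonabelian simple group, `q` a prime exceeding every prime
divisor of `|S|`, and `p` a prime with `p > 2q`, then the wreath product
`G = S ≀ A_p` has no supersolvable maximal subgroup `M` with `π(M) = π(G)`. -/
theorem wreath_no_supersolvable_maximal_with_full_pi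
    (S : Type*) [Group S] [Finite S] [IsSimpleGroup S]
    (hnonab : ¬ ∀ a b : S, a * b = b * a)
    (q : ℕ) (hq : q.Prime) (hqS : ∀ r : ℕ, r.Prime → r ∣ Nat.card S → r < q)
    (p : ℕ) (hp : p.Prime) (hpq : p > 2 * q)
    (M : Subgroup (SemidirectProduct (Fin p → S) (alternatingGroup (Fin p)) (wreathAut S p)))
    (hM : IsCoatom M) :
    ¬ (IsSupersolvable M ∧
        (Nat.card M).primeFactors =
          (Nat.card (SemidirectProduct (Fin p → S) (alternatingGroup (Fin p))
            (wreathAut S p))).primeFactors) := by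
  rintro ⟨hsup, -⟩
  have hsolv : Group.IsSolvable M := hsup.isSolvable
  have hN : (SemidirectProduct.inl (φ := wreathAut S p)).range.Normal := by
    rw [SemidirectProduct.range_inl_eq_ker_rightHom]
    infer_instance
  by_cases hle : (SemidirectProduct.inl (φ := wreathAut S p)).range ≤ M
  · have hpos : 0 < p := hp.pos
    let f : S →* M := (SemidirectProduct.inl.comp
      (MonoidHom.mulSingle (fun _ : Fin p => S) ⟨0, hpos⟩)).codRestrict M
        fun s => hle ⟨_, rfl⟩
    have hf : Function.Injective f := by
      intro a b hab
      exact Pi.mulSingle_injective _ (SemidirectProduct.inl_injective (congrArg Subtype.val hab))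
    have hS : Group.IsSolvable S := Group.isSolvable_of_isSolvable_injective hf
    exact hnonab (IsSimpleGroup.comm_iff_isSolvable.2 hS)
  · have htop : M ⊔ (SemidirectProduct.inl (φ := wreathAut S p)).range = ⊤ :=
      hM.2 _ (left_lt_sup.2 hle)
    have hsurj : Function.Surjective
        ((SemidirectProduct.rightHom (φ := wreathAut S p)).comp M.subtype) := by
      rw [← MonoidHom.range_eq_top, MonoidHom.range_comp, Subgroup.range_subtype]
      have hmap := congrArg (Subgroup.map (SemidirectProduct.rightHom (φ := wreathAut S p))) htop
      rwa [Subgroup.map_sup, SemidirectProduct.range_inl_eq_ker_rightHom,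
        (Subgroup.map_eq_bot_iff _).2 le_rfl, sup_bot_eq,
        Subgroup.map_top_of_surjective _ SemidirectProduct.rightHom_surjective] at hmap
    have hA : Group.IsSolvable (alternatingGroup (Fin p)) := Group.isSolvable_of_surjective hsurj
    have hq2 := hq.two_le
    exact alternatingGroup_not_isSolvable (by rw [Fintype.card_fin]; omega) hA
end

section
/- For every natural number n there exists a finite solvable group G of nilpotency (Fitting) length at least n such that no maximal subgroup M of G satisfies π(M) = π(G). -/
/-- `c` is a normal chain of length `m` for `G` from `⊥` to `⊤` with all
successive quotients nilpotent. -/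
def IsNilpotentNormalChain (G : Type*) [Group G] (m : ℕ) (c : ℕ → Subgroup G) : Prop :=
  c 0 = ⊥ ∧ c m = ⊤ ∧ (∀ i, c i ≤ c (i + 1)) ∧
  ∃ hn : ∀ i, (c i).Normal,
    ∀ i < m, letI := hn i;
      Group.IsNilpotent ((c (i + 1)).map (QuotientGroup.mk' (c i)))

/-- Some nontrivial element lies in every nontrivial normal subgroup. -/
def IsMonolithic (G : Type*) [Group G] : Prop :=
  ∃ x : G, x ≠ 1 ∧ ∀ H : Subgroup G, H.Normal → H ≠ ⊥ → x ∈ H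

theorem Subgroup.isNilpotent_map {G G' : Type*} [Group G] [Group G'] (f : G →* G')
    (H : Subgroup G) (hH : Group.IsNilpotent H) : Group.IsNilpotent (H.map f) :=
  Group.nilpotent_of_surjective (f.subgroupMap H) (f.subgroupMap_surjective H)

/-- A surjection maps a normal chain, with its bottom term dropped, to a normal chain, provided
the second term of the chain dies. -/
theorem IsNilpotentNormalChain.map_tail {E G : Type*} [Group E] [Group G] {f : E →* G}
    (hf : Function.Surjective f) {m : ℕ} {c : ℕ → Subgroup E}
    (hc : IsNilpotentNormalChain E (m + 1) c) (h1 : c 1 ≤ f.ker) :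
    IsNilpotentNormalChain G m fun i => (c (i + 1)).map f := by
  obtain ⟨-, htop, hle, hn, hnil⟩ := hc
  refine ⟨(Subgroup.map_eq_bot_iff _).2 h1, ?_, fun i => Subgroup.map_mono (hle _),
    fun i => (hn _).map f hf, fun i hi => ?_⟩
  · simp only [htop]
    exact Subgroup.map_top_of_surjective f hf
  · have := hn (i + 1)
    have := (hn (i + 1)).map f hf
    have h := Subgroup.isNilpotent_map
      (QuotientGroup.map (c (i + 1)) ((c (i + 1)).map f) f (Subgroup.le_comap_map _ _))
      _ (hnil (i + 1) (by lia))
    have e : (QuotientGroup.map (c (i + 1)) ((c (i + 1)).map f) f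
        (Subgroup.le_comap_map _ _)).comp (QuotientGroup.mk' (c (i + 1))) =
        (QuotientGroup.mk' ((c (i + 1)).map f)).comp f := by
      ext x
      rfl
    rw [Subgroup.map_map, e, ← Subgroup.map_map] at h
    exact h

/-- A nilpotent normal subgroup lies in any self-centralizing normal subgroup which is contained
in all nontrivial normal subgroups. -/
theorem Subgroup.le_of_isNilpotent_of_centralizer_le {E : Type*} [Group E] {V : Subgroup E}
    (hmin : ∀ H : Subgroup E, H.Normal → H ≠ ⊥ → V ≤ H)
    (hcent : Subgroup.centralizer (V : Set E) ≤ V)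
    (H : Subgroup E) [H.Normal] [Group.IsNilpotent H] : H ≤ V := by
  by_cases hH : H = ⊥
  · simp [hH]
  have : Nontrivial H := (Subgroup.nontrivial_iff_ne_bot H).2 hH
  have hZ' : (Subgroup.center H).map H.subtype ≠ ⊥ := by
    rw [Ne, Subgroup.map_eq_bot_iff_of_injective _ H.subtype_injective]
    exact Group.IsNilpotent.center_ne_bot H
  have hV := hmin _ inferInstance hZ'
  refine le_trans (fun h hh => ?_) hcent
  rw [Subgroup.mem_centralizer_iff]
  intro v hv
  obtain ⟨z, hz, rfl⟩ := hV hv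
  have := (Subgroup.mem_center_iff.1 hz) ⟨h, hh⟩
  exact (congrArg Subtype.val this).symm

/-- Extending by a faithful irreducible module raises the lower bound on the length of chains. -/
theorem IsNilpotentNormalChain.succ_le {E G : Type*} [Group E] [Group G] [Nontrivial E]
    {f : E →* G} (hf : Function.Surjective f)
    (hmin : ∀ H : Subgroup E, H.Normal → H ≠ ⊥ → f.ker ≤ H)
    (hcent : Subgroup.centralizer (f.ker : Set E) ≤ f.ker) {n : ℕ}
    (hG : ∀ (m : ℕ) (c : ℕ → Subgroup G), IsNilpotentNormalChain G m c → n ≤ m)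
    {m : ℕ} {c : ℕ → Subgroup E} (hc : IsNilpotentNormalChain E m c) : n + 1 ≤ m := by
  cases m with
  | zero => exact absurd (hc.1.symm.trans hc.2.1) bot_ne_top
  | succ m =>
    refine Nat.succ_le_succ (hG m _ (hc.map_tail hf ?_))
    obtain ⟨h0, -, -, hn, hnil⟩ := hc
    have := hn 0
    have := hn 1
    have h := hnil 0 (Nat.succ_pos m)
    have hinj : Function.Injective ((QuotientGroup.mk' (c 0)).subgroupMap (c 1)) := by
      rw [← MonoidHom.ker_eq_bot_iff, eq_bot_iff]
      rintro ⟨x, hx⟩ hk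
      have h2 : (QuotientGroup.mk' (c 0)) x = 1 := congrArg Subtype.val hk
      have h3 : x ∈ c 0 := (QuotientGroup.eq_one_iff x).1 h2
      rw [h0, Subgroup.mem_bot] at h3
      exact Subtype.ext h3
    have : Group.IsNilpotent (c 1) :=
      Group.nilpotent_of_surjective (MulEquiv.ofBijective _
        ⟨hinj, (QuotientGroup.mk' (c 0)).subgroupMap_surjective (c 1)⟩).symm.toMonoidHom
        (MulEquiv.surjective _)
    exact Subgroup.le_of_isNilpotent_of_centralizer_le hmin hcent (c 1)

/-- If no maximal subgroup of `G` has full prime spectrum, neither has one of an extension of `G`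
by an abelian minimal normal `p`-subgroup with `p` prime to the order of `G`. -/
theorem IsCoatom.primeFactors_card_ne {E G : Type*} [Group E] [Group G] [Finite E]
    {f : E →* G} (hf : Function.Surjective f)
    (hmin : ∀ H : Subgroup E, H.Normal → H ≠ ⊥ → f.ker ≤ H)
    (hcomm : ∀ v ∈ f.ker, ∀ w ∈ f.ker, v * w = w * v) {p k : ℕ} (hp : p.Prime)
    (hker : Nat.card f.ker = p ^ (k + 1)) (hpG : ¬ p ∣ Nat.card G)
    (hG : ∀ M : Subgroup G, IsCoatom M →
      (Nat.card M).primeFactors ≠ (Nat.card G).primeFactors)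
    {M : Subgroup E} (hM : IsCoatom M) :
    (Nat.card M).primeFactors ≠ (Nat.card E).primeFactors := by
  have : Finite G := Finite.of_surjective f hf
  have hE : Nat.card E = p ^ (k + 1) * Nat.card G := by
    rw [← Subgroup.card_mul_index f.ker, hker, Subgroup.index_ker,
      MonoidHom.range_eq_top.2 hf, Subgroup.card_top]
  intro heq
  by_cases hV : f.ker ≤ M
  · have hcm : (M.map f).comap f = M := Subgroup.comap_map_eq_self hV
    have hco : IsCoatom (M.map f) := by
      refine ⟨fun h => hM.1 ?_, fun K hK => ?_⟩
      · rw [← hcm, h, Subgroup.comap_top]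
      · have : K.comap f = ⊤ := hM.2 _ (by
          rw [← hcm]
          exact (Subgroup.comap_lt_comap_of_surjective hf).2 hK)
        rw [← Subgroup.map_comap_eq_self_of_surjective hf K, this,
          Subgroup.map_top_of_surjective f hf]
    have hMc : Nat.card M = p ^ (k + 1) * Nat.card (M.map f) := by
      have h1 := Subgroup.card_mul_index M
      have h2 := Subgroup.card_mul_index (M.map f)
      have h3 : (M.map f).index = M.index := by
        rw [← Subgroup.index_comap_of_surjective _ hf, hcm]
      rw [hE, ← h2, h3, ← mul_assoc] at h1
      exact Nat.eq_of_mul_eq_mul_right (Nat.pos_of_ne_zero Subgroup.index_ne_zero_of_finite) h1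
    have hpM : ¬ p ∣ Nat.card (M.map f) := fun h =>
      hpG (h.trans (Subgroup.card_subgroup_dvd_card _))
    apply hG _ hco
    have hpk : p ^ (k + 1) ≠ 0 := pow_ne_zero _ hp.ne_zero
    rw [hMc, hE, Nat.primeFactors_mul hpk Nat.card_pos.ne',
      Nat.primeFactors_mul hpk Nat.card_pos.ne', Nat.primeFactors_prime_pow k.succ_ne_zero hp]
      at heq
    have key : ∀ a : ℕ, ¬ p ∣ a → ({p} ∪ a.primeFactors).erase p = a.primeFactors := by
      intro a ha
      rw [← Finset.insert_eq, Finset.erase_insert]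
      exact fun h => ha (Nat.dvd_of_mem_primeFactors h)
    rw [← key _ hpM, heq, key _ hpG]
  · have hsup : M ⊔ f.ker = ⊤ := hM.2 _ (left_lt_sup.2 hV)
    have hnormal : (M ⊓ f.ker).Normal := by
      rw [← Subgroup.normalizer_eq_top_iff, eq_top_iff, ← hsup]
      refine sup_le (fun m hm => ?_) fun v hv => ?_
      · rw [Subgroup.mem_normalizer_iff]
        intro h
        simp only [Subgroup.mem_inf]
        refine and_congr ?_ ?_
        · rw [Subgroup.mul_mem_cancel_right _ (M.inv_mem hm), Subgroup.mul_mem_cancel_left _ hm]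
        · simp [MonoidHom.mem_ker]
      · rw [Subgroup.mem_normalizer_iff]
        intro h
        constructor
        · intro hh
          rwa [hcomm v hv h hh.2, mul_inv_cancel_right]
        · intro hh
          have hk : h ∈ f.ker := by
            have := hh.2
            simpa [MonoidHom.mem_ker] using this
          rwa [hcomm v hv h hk, mul_inv_cancel_right] at hh
    have hbot : M ⊓ f.ker = ⊥ := by
      by_contra h
      exact hV ((hmin _ hnormal h).trans inf_le_left)
    have hinj : Function.Injective (f.comp M.subtype) := by
      rw [← MonoidHom.ker_eq_bot_iff, eq_bot_iff]
      rintro ⟨x, hx⟩ hk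
      have : x ∈ M ⊓ f.ker := ⟨hx, hk⟩
      rw [hbot, Subgroup.mem_bot] at this
      exact Subtype.ext this
    have hdvd := Subgroup.card_dvd_of_injective _ hinj
    have hpE : p ∈ (Nat.card E).primeFactors := by
      rw [Nat.mem_primeFactors]
      exact ⟨hp, hE ▸ (dvd_pow_self p k.succ_ne_zero).mul_right _, Nat.card_pos.ne'⟩
    rw [← heq] at hpE
    exact hpG ((Nat.dvd_of_mem_primeFactors hpE).trans hdvd)

/-- A monolithic finite group of order prime to `p` acts faithfully and irreducibly on some
abelian `p`-group. -/
theorem IsMonolithic.exists_faithful_irreducible {G : Type} [Group G] [Finite G]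
    (hG : IsMonolithic G) {p : ℕ} (hp : p.Prime) (hpG : ¬ p ∣ Nat.card G) :
    ∃ (V : Type) (_ : CommGroup V) (_ : Finite V) (φ : G →* MulAut V) (k : ℕ),
      Nat.card V = p ^ (k + 1) ∧ Function.Injective φ ∧
      ∀ W : Subgroup V, (∀ g, ∀ w ∈ W, φ g w ∈ W) → W ≠ ⊥ → W = ⊤ := by
  have : Fact p.Prime := ⟨hp⟩
  obtain ⟨x, hx, hmono⟩ := hG
  have : NeZero (Nat.card G : ZMod p) :=
    ⟨fun h => hpG ((ZMod.natCast_eq_zero_iff _ _).1 h)⟩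
  obtain ⟨S, hS, hxS⟩ : ∃ S : Submodule (MonoidAlgebra (ZMod p) G) (MonoidAlgebra (ZMod p) G),
      IsSimpleModule (MonoidAlgebra (ZMod p) G) S ∧
      ¬ ∀ v ∈ S, MonoidAlgebra.of (ZMod p) G x * v = v := by
    by_contra! h
    have hle : ∀ v ∈ sSup {S : Submodule (MonoidAlgebra (ZMod p) G) (MonoidAlgebra (ZMod p) G) |
        IsSimpleModule (MonoidAlgebra (ZMod p) G) S}, MonoidAlgebra.of (ZMod p) G x * v = v := by
      intro v hv
      rw [sSup_eq_iSup'] at hv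
      induction hv using Submodule.iSup_induction' with
      | mem S v hv => exact h S S.2 v hv
      | zero => simp
      | add v w _ _ hv hw => rw [mul_add, hv, hw]
    have h1 := hle 1 (by
      rw [IsSemisimpleModule.sSup_simples_eq_top]
      trivial)
    rw [mul_one, ← map_one (MonoidAlgebra.of (ZMod p) G)] at h1
    exact hx (MonoidAlgebra.of_injective h1)
  let ψ : G →* Multiplicative (AddAut S) :=
    (DistribMulAction.toAddAut (MonoidAlgebra (ZMod p) G)ˣ S).comp <|
      (Units.map (MonoidAlgebra.of (ZMod p) G)).comp toUnits.toMonoidHom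
  let φ : G →* MulAut (Multiplicative S) := (MulAutMultiplicative S).symm.toMonoidHom.comp ψ
  have hφ : ∀ g (v : S), (φ g (Multiplicative.ofAdd v)).toAdd =
      MonoidAlgebra.of (ZMod p) G g • v := fun _ _ => rfl
  have hfin : Finite (MonoidAlgebra (ZMod p) G) := Module.finite_of_finite (ZMod p)
  have hnt : Nontrivial S := IsSimpleModule.nontrivial (MonoidAlgebra (ZMod p) G) S
  obtain ⟨k, hk⟩ := Nat.exists_eq_succ_of_ne_zero
    (Module.finrank_pos (R := ZMod p) (M := S)).ne'
  refine ⟨Multiplicative S, inferInstance, inferInstance, φ, k, ?_, ?_, fun W hW hW0 => ?_⟩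
  · rw [Nat.card_congr Multiplicative.toAdd, Module.natCard_eq_pow_finrank (K := ZMod p), hk,
      Nat.card_zmod]
  · rw [← MonoidHom.ker_eq_bot_iff]
    by_contra hne
    refine hxS fun v hv => ?_
    have hx1 : φ x = 1 := hmono _ inferInstance hne
    have := hφ x ⟨v, hv⟩
    rw [hx1] at this
    exact (congrArg Subtype.val this).symm
  · let W' : Submodule (MonoidAlgebra (ZMod p) G) S :=
      { Subgroup.toAddSubgroup' W with
        smul_mem' := fun a v hv => by
          change Multiplicative.ofAdd (a • v) ∈ W
          induction a using MonoidAlgebra.induction_on with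
          | of g => exact hW g _ hv
          | add a b ha hb =>
            rw [add_smul, ofAdd_add]
            exact W.mul_mem ha hb
          | smul r a ha =>
            have hr : (r • a) • v = r.val • (a • v) := by
              rw [smul_assoc, ← Nat.cast_smul_eq_nsmul (ZMod p), ZMod.natCast_zmod_val]
            rw [hr, ofAdd_nsmul]
            exact W.pow_mem ha _ }
    have hW' : ∀ v : S, v ∈ W' ↔ Multiplicative.ofAdd v ∈ W := fun _ => Iff.rfl
    rcases eq_bot_or_eq_top W' with h | h
    · refine absurd ((Subgroup.eq_bot_iff_forall W).2 fun w hw => ?_) hW0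
      have : w.toAdd ∈ W' := hw
      rw [h, Submodule.mem_bot] at this
      exact this
    · refine (Subgroup.eq_top_iff' W).2 fun w => ?_
      have : w.toAdd ∈ W' := h ▸ Submodule.mem_top
      exact this

/-- If `G` acts faithfully on the abelian group `V`, then `V` is self-centralizing in `V ⋊ G`. -/
theorem SemidirectProduct.centralizer_ker_rightHom_le {V G : Type*} [CommGroup V] [Group G]
    {φ : G →* MulAut V} (hφ : Function.Injective φ) :
    Subgroup.centralizer ((rightHom : V ⋊[φ] G →* G).ker : Set (V ⋊[φ] G)) ≤
      (rightHom : V ⋊[φ] G →* G).ker := by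
  intro h hh
  rw [Subgroup.mem_centralizer_iff] at hh
  rw [MonoidHom.mem_ker]
  refine hφ (MulEquiv.ext fun v => ?_)
  have := congrArg left (hh (inl v) (by simp [MonoidHom.mem_ker]))
  simp only [mul_left, left_inl, right_inl, map_one, MulAut.one_apply] at this
  rw [mul_comm] at this
  simpa using (mul_left_cancel this).symm

/-- If `G` acts faithfully and irreducibly on the abelian group `V`, then `V` lies in every
nontrivial normal subgroup of `V ⋊ G`. -/
theorem SemidirectProduct.ker_rightHom_le_of_normal {V G : Type*} [CommGroup V] [Group G]
    {φ : G →* MulAut V} (hφ : Function.Injective φ)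
    (hirr : ∀ W : Subgroup V, (∀ g, ∀ w ∈ W, φ g w ∈ W) → W ≠ ⊥ → W = ⊤)
    (H : Subgroup (V ⋊[φ] G)) (hH : H.Normal) (hH0 : H ≠ ⊥) :
    (rightHom : V ⋊[φ] G →* G).ker ≤ H := by
  have hinv : ∀ g, ∀ w ∈ H.comap (inl : V →* V ⋊[φ] G), φ g w ∈ H.comap inl := by
    intro g w hw
    rw [Subgroup.mem_comap, inl_aut, map_inv]
    exact hH.conj_mem _ hw _
  rw [← range_inl_eq_ker_rightHom]
  by_cases hbot : H.comap (inl : V →* V ⋊[φ] G) = ⊥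
  · have hdisj : Disjoint H (rightHom : V ⋊[φ] G →* G).ker := by
      rw [← range_inl_eq_ker_rightHom, Subgroup.disjoint_def]
      rintro _ hx ⟨v, rfl⟩
      have : v ∈ H.comap (inl : V →* V ⋊[φ] G) := hx
      rw [hbot, Subgroup.mem_bot] at this
      rw [this, map_one]
    refine absurd (disjoint_self.1 (hdisj.mono_right fun h hh => ?_)) hH0
    refine centralizer_ker_rightHom_le hφ (Subgroup.mem_centralizer_iff.2 fun v hv => ?_)
    exact (Subgroup.commute_of_normal_of_disjoint _ _ hH inferInstance hdisj h v hh hv).symm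
  · rintro _ ⟨v, rfl⟩
    have : v ∈ H.comap (inl : V →* V ⋊[φ] G) := hirr _ hinv hbot ▸ Subgroup.mem_top v
    exact this

/-- For every `n` there is a monolithic finite solvable group of nilpotency length at least `n` in
which no maximal subgroup has full prime spectrum. -/
theorem exists_monolithic_solvable_group_no_maximal_full_pi (n : ℕ) :
    ∃ (G : Type) (_ : Group G) (_ : Finite G), IsMonolithic G ∧ Group.IsSolvable G ∧
      (∀ (m : ℕ) (c : ℕ → Subgroup G), IsNilpotentNormalChain G m c → n ≤ m) ∧
      ∀ M : Subgroup G, IsCoatom M →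
        (Nat.card M).primeFactors ≠ (Nat.card G).primeFactors := by
  induction n with
  | zero =>
    have hcard : Nat.card (Multiplicative (ZMod 2)) = 2 := Nat.card_zmod 2
    have : IsSimpleGroup (Multiplicative (ZMod 2)) :=
      isSimpleGroup_of_prime_card (p := 2) hcard
    refine ⟨Multiplicative (ZMod 2), inferInstance, inferInstance, ?_, inferInstance,
      fun _ _ _ => Nat.zero_le _, fun M hM => ?_⟩
    · obtain ⟨x, hx⟩ := exists_ne (1 : Multiplicative (ZMod 2))
      exact ⟨x, hx, fun H hH hH0 => (hH.eq_bot_or_eq_top.resolve_left hH0) ▸ Subgroup.mem_top x⟩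
    · have hbot : M = ⊥ := (inferInstance : M.Normal).eq_bot_or_eq_top.resolve_right hM.1
      rw [hbot, Subgroup.card_bot, hcard, Nat.primeFactors_one, Nat.prime_two.primeFactors]
      exact (Finset.singleton_ne_empty 2).symm
  | succ n ih =>
    obtain ⟨G, _, _, hmono, hsolv, hchain, hmax⟩ := ih
    obtain ⟨p, hpG, hp⟩ := Nat.exists_infinite_primes (Nat.card G + 1)
    have hpG : ¬ p ∣ Nat.card G := fun h => absurd (Nat.le_of_dvd Nat.card_pos h) (by lia)
    obtain ⟨V, _, _, φ, k, hV, hφ, hirr⟩ := hmono.exists_faithful_irreducible hp hpG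
    have hVnt : Nontrivial V := by
      rw [← Finite.one_lt_card_iff_nontrivial, hV]
      exact Nat.one_lt_pow k.succ_ne_zero hp.one_lt
    obtain ⟨v, hv⟩ := exists_ne (1 : V)
    have hfin : Finite (V ⋊[φ] G) := Finite.of_equiv _ SemidirectProduct.equivProd.symm
    have hnt : Nontrivial (V ⋊[φ] G) := SemidirectProduct.inl_injective.nontrivial
    have hmin := SemidirectProduct.ker_rightHom_le_of_normal hφ hirr
    have hcent := SemidirectProduct.centralizer_ker_rightHom_le hφ
    have hker := SemidirectProduct.range_inl_eq_ker_rightHom (φ := φ)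
    refine ⟨V ⋊[φ] G, inferInstance, hfin, ⟨SemidirectProduct.inl v, ?_, fun H hH hH0 =>
      hmin H hH hH0 (by simp [MonoidHom.mem_ker])⟩,
      Group.isSolvable_of_ker_le_range SemidirectProduct.inl SemidirectProduct.rightHom hker.ge,
      fun m c hc => hc.succ_le SemidirectProduct.rightHom_surjective hmin hcent hchain,
      fun M hM => hM.primeFactors_card_ne SemidirectProduct.rightHom_surjective hmin ?_ hp
        (k := k) ?_ hpG hmax⟩
    · rwa [Ne, ← map_one SemidirectProduct.inl, SemidirectProduct.inl_inj]
    · rw [← hker]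
      rintro _ ⟨v, rfl⟩ _ ⟨w, rfl⟩
      rw [← map_mul, mul_comm, map_mul]
    · rw [← hker, ← hV]
      exact (Nat.card_congr
        (MonoidHom.ofInjective SemidirectProduct.inl_injective).toEquiv).symm

/-- For every `n` there is a finite solvable group of nilpotency (Fitting) length
at least `n` in which no maximal subgroup `M` satisfies `π(M) = π(G)`. -/
theorem exists_solvable_group_no_maximal_full_pi_large_fitting_length (n : ℕ) :
    ∃ (G : Type) (_ : Group G) (_ : Finite G), IsSolvable G ∧
      (∀ (m : ℕ) (c : ℕ → Subgroup G), IsNilpotentNormalChain G m c → n ≤ m) ∧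
      ∀ M : Subgroup G, IsCoatom M →
        (Nat.card M).primeFactors ≠ (Nat.card G).primeFactors := by
  obtain ⟨G, hG, hfin, -, h⟩ := exists_monolithic_solvable_group_no_maximal_full_pi n
  exact ⟨G, hG, hfin, h⟩
end

section
/- Let p be a prime, let V be a nontrivial elementary abelian p-group (a nontrivial finite abelian group of exponent p), and let L be a finite group of order coprime to p acting faithfully on V by automorphisms. If the semidirect product L ⋉ V is supersolvable, then L is abelian of exponent dividing p−1; in particular, every prime divisor of |L| is less than p. -/
section ChainActions

variable {V L : Type*} [CommGroup V] [Group L] {φ : L →* MulAut V}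

/-- In a supersolvable semidirect product `V ⋊ L`, the group `V` has a chain of `L`-invariant
subgroups such that each element of `L` acts on each factor as a power map. -/
theorem IsSupersolvable.exists_chain_zpow (hss : IsSupersolvable (V ⋊[φ] L)) :
    ∃ (k : ℕ) (W : ℕ → Subgroup V), W 0 = ⊥ ∧ W k = ⊤ ∧
      (∀ i g, ∀ v ∈ W i, φ g v ∈ W i) ∧
      ∀ i < k, ∀ g, ∃ m : ℤ, ∀ v ∈ W (i + 1), φ g v / v ^ m ∈ W i := by
  obtain ⟨k, c, h0, hk, -, hn, hcyc⟩ := hss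
  have hinv : ∀ i g, ∀ v ∈ (c i).comap (SemidirectProduct.inl : V →* V ⋊[φ] L),
      φ g v ∈ (c i).comap (SemidirectProduct.inl : V →* V ⋊[φ] L) := by
    intro i g v hv
    rw [Subgroup.mem_comap] at hv ⊢
    rw [SemidirectProduct.inl_aut]
    simpa using (hn i).conj_mem _ hv (SemidirectProduct.inr g)
  refine ⟨k, fun i => (c i).comap SemidirectProduct.inl, ?_, ?_, hinv, ?_⟩
  · ext v
    simp [h0, map_eq_one_iff _ SemidirectProduct.inl_injective]
  · simp [hk]
  · intro i hi g
    have := hn i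
    have : IsCyclic ((c (i + 1)).map (QuotientGroup.mk' (c i))) := hcyc i hi
    let f : (c (i + 1)).comap (SemidirectProduct.inl : V →* V ⋊[φ] L) →*
        (c (i + 1)).map (QuotientGroup.mk' (c i)) :=
      ((QuotientGroup.mk' (c i)).subgroupMap (c (i + 1))).comp
        (SemidirectProduct.inl.subgroupComap (c (i + 1)))
    have hf : ∀ x, f x = 1 ↔ (x : V) ∈ (c i).comap (SemidirectProduct.inl : V →* V ⋊[φ] L) := by
      intro x
      rw [Subtype.ext_iff]
      exact QuotientGroup.eq_one_iff _
    obtain ⟨⟨_, v₀, rfl⟩, hgen⟩ := IsCyclic.exists_generator (α := f.range)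
    have hpow : ∀ v ∈ (c (i + 1)).comap (SemidirectProduct.inl : V →* V ⋊[φ] L), ∃ n : ℤ,
        v / (v₀ : V) ^ n ∈ (c i).comap (SemidirectProduct.inl : V →* V ⋊[φ] L) := by
      intro v hv
      obtain ⟨n, hn⟩ := Subgroup.mem_zpowers_iff.mp (hgen ⟨f ⟨v, hv⟩, _, rfl⟩)
      refine ⟨n, (hf (⟨v, hv⟩ / v₀ ^ n)).mp ?_⟩
      rw [map_div, map_zpow, div_eq_one]
      exact (congrArg Subtype.val hn).symm
    obtain ⟨m, hm⟩ := hpow _ (hinv _ g _ v₀.2)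
    refine ⟨m, fun v hv => ?_⟩
    obtain ⟨n, hn⟩ := hpow v hv
    have hfactor : φ g v / v ^ m = φ g (v / (v₀ : V) ^ n) * (φ g v₀ / (v₀ : V) ^ m) ^ n /
        (v / (v₀ : V) ^ n) ^ m := by
      generalize hw : v / (v₀ : V) ^ n = w
      generalize hu : φ g v₀ / (v₀ : V) ^ m = u
      rw [div_eq_iff_eq_mul] at hw hu
      rw [hw, map_mul, map_zpow, hu, mul_zpow, mul_zpow, ← zpow_mul, ← zpow_mul, mul_comm n m,
        ← mul_assoc, mul_div_mul_right_eq_div]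
    rw [hfactor]
    exact div_mem (mul_mem (hinv _ _ _ hn) (zpow_mem hm n)) (zpow_mem hn m)

/-- An automorphism acting trivially on the factors of a chain of length `k` in a group of
exponent dividing `p` has order dividing `p ^ k`. -/
theorem pow_prime_pow_eq_one_of_trivial_on_factors {p k : ℕ} {W : ℕ → Subgroup V}
    (hV : ∀ v : V, v ^ p = 1) (h0 : W 0 = ⊥) (hk : W k = ⊤) (g : MulAut V)
    (hinv : ∀ i, ∀ v ∈ W i, g v ∈ W i)
    (hg : ∀ i < k, ∀ v ∈ W (i + 1), g v / v ∈ W i) : g ^ p ^ k = 1 := by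
  have hfix : ∀ i ≤ k, ∀ v ∈ W i, (g ^ p ^ i) v = v := by
    intro i
    induction i with
    | zero =>
      intro _ v hv
      rw [h0, Subgroup.mem_bot] at hv
      simp [hv]
    | succ i ih =>
      intro hi v hv
      have hW : ∀ j : ℕ, (g ^ j) v / v ∈ W i := by
        intro j
        induction j with
        | zero => simp
        | succ j ihj =>
          have := mul_mem (hinv i _ ihj) (hg i (by omega) v hv)
          rwa [map_div, div_mul_div_cancel, ← MulAut.mul_apply, ← pow_succ'] at this
      have hit : ∀ j : ℕ, ((g ^ p ^ i) ^ j) v = v * ((g ^ p ^ i) v / v) ^ j := by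
        intro j
        induction j with
        | zero => simp
        | succ j ihj =>
          rw [pow_succ', MulAut.mul_apply, ihj, map_mul, map_pow,
            ih (by omega) _ (hW _), pow_succ', ← mul_assoc, mul_div_cancel]
      rw [pow_succ, pow_mul, hit, hV, mul_one]
  ext v
  exact hfix k le_rfl v (hk ▸ Subgroup.mem_top v)

/-- If `g` acts on `A / B` as the `m`-th power map and `A` has exponent dividing `p`, then
`g ^ (p - 1)` acts trivially on `A / B`. -/
theorem pow_sub_one_apply_div_mem {p : ℕ} (hp : p.Prime) {A B : Subgroup V}
    (hV : ∀ v : V, v ^ p = 1) (hB : ∀ g, ∀ v ∈ B, φ g v ∈ B) {g : L} {m : ℤ}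
    (hm : ∀ v ∈ A, φ g v / v ^ m ∈ B) {v : V} (hv : v ∈ A) :
    φ (g ^ (p - 1)) v / v ∈ B := by
  by_cases hpm : (p : ℤ) ∣ m
  · obtain ⟨t, rfl⟩ := hpm
    have hgv : φ g v ∈ B := by simpa [zpow_mul, hV] using hm v hv
    have hvB : v ∈ B := by simpa using hB g⁻¹ _ hgv
    exact div_mem (hB _ _ hvB) hvB
  · have hpow : ∀ j : ℕ, φ (g ^ j) v / v ^ m ^ j ∈ B := by
      intro j
      induction j with
      | zero => simp
      | succ j ih =>
        have := mul_mem (hB g _ ih) (zpow_mem (hm v hv) (m ^ j))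
        rwa [map_div, map_zpow, div_zpow, div_mul_div_cancel, ← MulAut.mul_apply, ← map_mul,
          ← pow_succ', ← zpow_mul, ← pow_succ'] at this
    have hfermat : (p : ℤ) ∣ m ^ (p - 1) - 1 :=
      (Int.ModEq.pow_card_sub_one_eq_one hp
        ((Nat.prime_iff_prime_int.mp hp).coprime_iff_not_dvd.mpr hpm).symm).symm.dvd
    obtain ⟨t, ht⟩ := hfermat
    have hvm : v ^ m ^ (p - 1) = v := by
      rw [sub_eq_iff_eq_add.mp ht, zpow_add, zpow_mul, zpow_natCast, hV]
      simp
    simpa only [hvm] using hpow (p - 1)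

/-- If `a` and `b` act on `A / B` as power maps, their commutator acts trivially on `A / B`. -/
theorem commutator_apply_div_mem {A B : Subgroup V} (hA : ∀ g, ∀ v ∈ A, φ g v ∈ A) {a b : L}
    {m n : ℤ} (ha : ∀ v ∈ A, φ a v / v ^ m ∈ B) (hb : ∀ v ∈ A, φ b v / v ^ n ∈ B)
    {v : V} (hv : v ∈ A) : φ (a * b * (b * a)⁻¹) v / v ∈ B := by
  have hcomp : ∀ {a b : L} {m n : ℤ}, (∀ v ∈ A, φ a v / v ^ m ∈ B) →
      (∀ v ∈ A, φ b v / v ^ n ∈ B) → ∀ u ∈ A, φ (a * b) u / u ^ (n * m) ∈ B := by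
    intro a b m n ha hb u hu
    have := mul_mem (ha _ (hA b u hu)) (zpow_mem (hb u hu) m)
    rwa [div_zpow, div_mul_div_cancel, ← MulAut.mul_apply, ← map_mul, ← zpow_mul] at this
  have hu := hA (b * a)⁻¹ v hv
  have hab := hcomp ha hb _ hu
  have hba := hcomp hb ha _ hu
  rw [mul_comm m n] at hba
  have hdiv := div_mem hab hba
  rw [div_div_div_cancel_right, ← MulAut.mul_apply, ← MulAut.mul_apply, ← map_mul, ← map_mul,
    mul_inv_cancel, map_one, MulAut.one_apply] at hdiv
  exact hdiv

end ChainActions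

/-- If `L` is a finite group of order coprime to a prime `p` acting faithfully on a
nontrivial elementary abelian `p`-group `V`, and the semidirect product `L ⋉ V` is
supersolvable, then `L` is abelian of exponent dividing `p - 1`; in particular
every prime divisor of `|L|` is less than `p`. -/
theorem abelian_of_supersolvable_semidirect_elementary_abelian
    (p : ℕ) (hp : p.Prime)
    (V : Type*) [CommGroup V] [Finite V] [Nontrivial V]
    (hV : Monoid.exponent V = p)
    (L : Type*) [Group L] [Finite L] (hL : (Nat.card L).Coprime p)
    (φ : L →* MulAut V) (hφ : Function.Injective φ)
    (hss : IsSupersolvable (SemidirectProduct V L φ)) :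
    (∀ a b : L, a * b = b * a) ∧
    Monoid.exponent L ∣ p - 1 ∧
    ∀ q : ℕ, q.Prime → q ∣ Nat.card L → q < p := by
  have hVp : ∀ v : V, v ^ p = 1 := fun v => hV ▸ Monoid.pow_exponent_eq_one v
  obtain ⟨k, W, h0, hk, hinv, hpow⟩ := hss.exists_chain_zpow
  have htriv : ∀ g : L, (∀ i < k, ∀ v ∈ W (i + 1), φ g v / v ∈ W i) → g = 1 := by
    intro g hg
    have hgp : g ^ p ^ k = 1 := hφ <| by
      rw [map_pow, map_one]
      exact pow_prime_pow_eq_one_of_trivial_on_factors hVp h0 hk _ (fun i => hinv i g) hg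
    exact orderOf_eq_one_iff.mp <| Nat.eq_one_of_dvd_coprimes (hL.pow_right k)
      (orderOf_dvd_natCard g) (orderOf_dvd_of_pow_eq_one hgp)
  have hexp : Monoid.exponent L ∣ p - 1 :=
    Monoid.exponent_dvd_of_forall_pow_eq_one fun g => htriv _ fun i hi v hv => by
      obtain ⟨m, hm⟩ := hpow i hi g
      exact pow_sub_one_apply_div_mem hp hVp (hinv i) hm hv
  refine ⟨fun a b => mul_inv_eq_one.mp <| htriv _ fun i hi v hv => ?_, hexp, fun q hq hqL => ?_⟩
  · obtain ⟨m, hm⟩ := hpow i hi a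
    obtain ⟨n, hn⟩ := hpow i hi b
    exact commutator_apply_div_mem (hinv (i + 1)) hm hn hv
  · have : Fact q.Prime := ⟨hq⟩
    obtain ⟨g, rfl⟩ := exists_prime_orderOf_dvd_card' q hqL
    have hqp : orderOf g ∣ p - 1 := (Monoid.order_dvd_exponent g).trans hexp
    have := Nat.le_of_dvd (Nat.sub_pos_of_lt hp.one_lt) hqp
    have := hp.one_lt
    omega
end
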